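/- arXiv:math/0109211 — 6 statements merged into one kernel-verified Lean document; each statement's English description precedes it below -/
import Mathlib

section
/- Let A be a unital C*-algebra and let x ∈ A. Then the following are equivalent: (i) ‖x‖ < 1; (ii) 1 − x is invertible in A and there exists ε > 0 such that (1 − x)⁻¹ + ((1 − x)⁻¹)* ≥ (1 + ε)·1. -/
section

variable {A : Type*} [CStarAlgebra A] [PartialOrder A] [StarOrderedRing A]

lemma star_mul_self_le_norm_sq_smul_one (a : A) : star a * a ≤ (‖a‖ ^ 2) • (1 : A) := by
  simpa [Algebra.algebraMap_eq_smul_one] using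
    CStarAlgebra.star_mul_le_algebraMap_norm_sq (a := a)

lemma smul_one_le_re_inverse_one_sub_iff {x : A} (hu : IsUnit (1 - x)) (ε : ℝ) :
    (1 + ε) • (1 : A) ≤ Ring.inverse (1 - x) + star (Ring.inverse (1 - x)) ↔
      ε • (star (1 - x) * (1 - x)) ≤ 1 - star x * x := by
  have hvu := Ring.inverse_mul_cancel _ hu
  set v := Ring.inverse (1 - x)
  have hsvu : star (1 - x) * star v = 1 := by rw [← star_mul, hvu, star_one]
  have hl : star (1 - x) * ((1 + ε) • (1 : A)) * (1 - x) =
      star (1 - x) * (1 - x) + ε • (star (1 - x) * (1 - x)) := by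
    rw [mul_smul_comm, smul_mul_assoc, mul_one, add_smul, one_smul]
  have hr : star (1 - x) * (v + star v) * (1 - x) =
      star (1 - x) * (1 - x) + (1 - star x * x) := by
    rw [mul_add, add_mul, mul_assoc, hvu, hsvu, star_sub, star_one]
    noncomm_ring
  rw [← sub_nonneg, ← hu.star_left_conjugate_nonneg_iff, mul_sub (star (1 - x)),
    sub_mul _ _ (1 - x), sub_nonneg, hl, hr, add_le_add_iff_left]

end

/-- **Lemma 3.4.** In a unital C*-algebra `A`, for `x ∈ A` the following are
equivalent: (i) `‖x‖ < 1`; (ii) `1 - x` is invertible and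
`(1 - x)⁻¹ + ((1 - x)⁻¹)* ≥ (1 + ε) • 1` for some `ε > 0`. -/
theorem norm_lt_one_iff_isUnit_one_sub_and_re_inv_ge
    {A : Type*} [CStarAlgebra A] [PartialOrder A] [StarOrderedRing A] [Nontrivial A]
    (x : A) :
    ‖x‖ < 1 ↔
      (IsUnit (1 - x) ∧ ∃ ε : ℝ, 0 < ε ∧
        (1 + ε) • (1 : A) ≤ Ring.inverse (1 - x) + star (Ring.inverse (1 - x))) := by
  constructor
  · intro hx
    have hu : IsUnit (1 - x) := isUnit_one_sub_of_norm_lt_one hx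
    have hc : 0 < ‖1 - x‖ ^ 2 := by have := norm_pos_iff.2 hu.ne_zero; positivity
    have hd : 0 < 1 - ‖x‖ ^ 2 := by nlinarith [norm_nonneg x]
    refine ⟨hu, (1 - ‖x‖ ^ 2) / ‖1 - x‖ ^ 2, div_pos hd hc, ?_⟩
    rw [smul_one_le_re_inverse_one_sub_iff hu]
    calc _ ≤ ((1 - ‖x‖ ^ 2) / ‖1 - x‖ ^ 2) • ((‖1 - x‖ ^ 2) • (1 : A)) :=
          smul_le_smul_of_nonneg_left (star_mul_self_le_norm_sq_smul_one _) (div_pos hd hc).le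
      _ = 1 - (‖x‖ ^ 2) • (1 : A) := by
          rw [smul_smul, div_mul_cancel₀ _ hc.ne', sub_smul, one_smul]
      _ ≤ _ := sub_le_sub_left (star_mul_self_le_norm_sq_smul_one x) _
  · rintro ⟨hu, ε, hε, h⟩
    rw [smul_one_le_re_inverse_one_sub_iff hu] at h
    have hvu := Ring.inverse_mul_cancel _ hu
    set v := Ring.inverse (1 - x)
    have hv : v ≠ 0 := left_ne_zero_of_mul_eq_one hvu
    have hc : 0 < ‖v‖ ^ 2 := by have := norm_pos_iff.2 hv; positivity
    have hone : (1 : A) ≤ (‖v‖ ^ 2) • (star (1 - x) * (1 - x)) := by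
      calc (1 : A) = star (1 - x) * (star v * v) * (1 - x) := by
            rw [← mul_assoc, ← star_mul, mul_assoc, hvu, star_one, one_mul]
        _ ≤ star (1 - x) * ((‖v‖ ^ 2) • (1 : A)) * (1 - x) :=
            star_left_conjugate_le_conjugate (star_mul_self_le_norm_sq_smul_one v) _
        _ = _ := by simp only [mul_smul_comm, smul_mul_assoc, mul_one]
    have hδ : 0 < ε / ‖v‖ ^ 2 := div_pos hε hc
    have hlow : (ε / ‖v‖ ^ 2) • (1 : A) ≤ 1 - star x * x := by
      refine (smul_le_smul_of_nonneg_left hone hδ.le).trans ?_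
      rwa [smul_smul, div_mul_cancel₀ _ hc.ne']
    have hle : star x * x ≤ algebraMap ℝ A (max (1 - ε / ‖v‖ ^ 2) 0) := by
      refine le_trans ?_ (algebraMap_mono A (le_max_left _ _))
      rw [Algebra.algebraMap_eq_smul_one, sub_smul, one_smul]
      exact le_sub_comm.1 hlow
    rw [← CStarAlgebra.norm_le_iff_le_algebraMap _ (le_max_right _ _) (star_mul_self_nonneg x),
      CStarRing.norm_star_mul_self] at hle
    have hlt : max (1 - ε / ‖v‖ ^ 2) 0 < 1 := max_lt (by linarith) one_pos
    nlinarith [norm_nonneg x]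
end

section
/- Let A be a unital C*-algebra and let x ∈ A with ‖x‖ < 1. Then 1 − x is invertible in A and (1 − x)⁻¹ + ((1 − x)⁻¹)* ≥ (1 + 4⁻¹(1 − ‖x‖²))·1. -/
/-- An element of a C*-algebra with `‖a‖ ≤ r` satisfies `a⋆ a ≤ r²`. -/
lemma CStarAlgebra.star_mul_self_le_sq_smul_one {A : Type*} [CStarAlgebra A] [PartialOrder A]
    [StarOrderedRing A] {a : A} {r : ℝ} (h : ‖a‖ ≤ r) :
    star a * a ≤ (r ^ 2) • (1 : A) := by
  have h1 := (IsSelfAdjoint.star_mul_self a).le_algebraMap_norm_self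
  rw [CStarRing.norm_star_mul_self, Algebra.algebraMap_eq_smul_one] at h1
  refine h1.trans (smul_le_smul_of_nonneg_right ?_ zero_le_one)
  nlinarith [norm_nonneg a]

/-- Quantitative form of (i) ⇒ (ii) in Lemma 3.4: if `‖x‖ < 1` in a unital
C*-algebra, then `1 - x` is invertible and
`(1 - x)⁻¹ + ((1 - x)⁻¹)* ≥ (1 + 4⁻¹ (1 - ‖x‖²)) • 1`. -/
theorem re_inv_one_sub_ge_of_norm_lt_one
    {A : Type*} [CStarAlgebra A] [PartialOrder A] [StarOrderedRing A] [Nontrivial A]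
    (x : A) (hx : ‖x‖ < 1) :
    IsUnit (1 - x) ∧
      (1 + 4⁻¹ * (1 - ‖x‖ ^ 2)) • (1 : A) ≤
        Ring.inverse (1 - x) + star (Ring.inverse (1 - x)) := by
  have hu : IsUnit (1 - x) := isUnit_one_sub_of_norm_lt_one hx
  refine ⟨hu, ?_⟩
  set y := Ring.inverse (1 - x)
  have hy : (1 - x) * y = 1 := Ring.mul_inverse_cancel _ hu
  have hy' : star y * star (1 - x) = 1 := by rw [← star_mul, hy, star_one]
  set c : ℝ := 4⁻¹ * (1 - ‖x‖ ^ 2) with hc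
  have hc0 : 0 ≤ c := by nlinarith [norm_nonneg x]
  have hxx := CStarAlgebra.star_mul_self_le_sq_smul_one (le_refl ‖x‖)
  have hnorm : ‖1 - x‖ ≤ 2 := by
    have := norm_sub_le (1 : A) x
    rw [CStarRing.norm_one] at this
    linarith
  have hsub := smul_le_smul_of_nonneg_left
    (CStarAlgebra.star_mul_self_le_sq_smul_one hnorm) hc0
  have hpos : 0 ≤ 1 - star x * x - c • (star (1 - x) * (1 - x)) := by
    have hadd := sub_nonneg.mpr (add_le_add hxx hsub)
    convert hadd using 1
    rw [smul_smul, ← add_smul, show ‖x‖ ^ 2 + c * 2 ^ 2 = 1 by rw [hc]; ring, one_smul]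
    abel
  have hconj := star_left_conjugate_nonneg hpos y
  have hxx' : 1 - star x * x =
      (1 - x) + star (1 - x) - star (1 - x) * (1 - x) := by
    rw [star_sub, star_one]
    noncomm_ring
  have hgram : star y * (star (1 - x) * (1 - x)) * y = 1 := by
    rw [← mul_assoc, hy', one_mul, hy]
  rw [hxx', mul_sub, mul_sub, mul_add, sub_mul, sub_mul, add_mul, mul_smul_comm, smul_mul_assoc,
    hgram, mul_assoc (star y) (1 - x), hy, hy', mul_one, one_mul] at hconj
  rw [← sub_nonneg, add_smul, one_smul]
  convert hconj using 1
  abel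
end

section
/- Let A be a unital C*-algebra and let x ∈ A. If 1 − x is invertible in A and there exists ε > 0 with (1 − x)⁻¹ + ((1 − x)⁻¹)* ≥ (1 + ε)·1, then ‖x‖ < 1. -/
/-- Implication (ii) ⇒ (i) in Lemma 3.4: if `1 - x` is invertible in a unital
C*-algebra and `(1 - x)⁻¹ + ((1 - x)⁻¹)* ≥ (1 + ε) • 1` for some `ε > 0`,
then `‖x‖ < 1`. -/
theorem norm_lt_one_of_re_inv_one_sub_ge
    {A : Type*} [CStarAlgebra A] [PartialOrder A] [StarOrderedRing A] [Nontrivial A]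
    (x : A) (hu : IsUnit (1 - x)) (ε : ℝ) (hε : 0 < ε)
    (h : (1 + ε) • (1 : A) ≤ Ring.inverse (1 - x) + star (Ring.inverse (1 - x))) :
    ‖x‖ < 1 := by
  set y : A := 1 - x with hy
  set b : A := Ring.inverse y
  have hby : b * y = 1 := Ring.inverse_mul_cancel y hu
  have hyb : star y * star b = 1 := by rw [← star_mul, hby, star_one]
  have hbM : star b * b ≤ algebraMap ℝ A (‖b‖ ^ 2) := by
    refine (CStarAlgebra.norm_le_iff_le_algebraMap _ (sq_nonneg _) (star_mul_self_nonneg b)).1 ?_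
    rw [CStarRing.norm_star_mul_self, sq]
  have hb0 : 0 < ‖b‖ ^ 2 := by
    have : b ≠ 0 := fun hb => by simp [hb] at hby
    positivity
  have hy_lower : (1 : A) ≤ ‖b‖ ^ 2 • (star y * y) := by
    have := star_left_conjugate_le_conjugate hbM y
    rwa [← mul_assoc, hyb, one_mul, hby, Algebra.algebraMap_eq_smul_one, mul_smul_comm, mul_one,
      smul_mul_assoc] at this
  have hy_upper : (1 + ε) • (star y * y) ≤ star y + y := by
    have := star_left_conjugate_le_conjugate h y
    rwa [mul_smul_comm, mul_one, smul_mul_assoc, mul_add, hyb, add_mul, one_mul, mul_assoc, hby,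
      mul_one] at this
  have hscaled : (ε / ‖b‖ ^ 2) • (1 : A) ≤ ε • (star y * y) := by
    have := smul_le_smul_of_nonneg_left hy_lower (div_pos hε hb0).le
    rwa [smul_smul, div_mul_cancel₀ _ hb0.ne'] at this
  have hxx : star x * x = 1 - (star y + y) + star y * y := by
    simp only [hy, star_sub, star_one]
    noncomm_ring
  have hx_le : star x * x ≤ (1 - ε / ‖b‖ ^ 2) • (1 : A) := by
    rw [add_smul, one_smul] at hy_upper
    rw [hxx, sub_smul, one_smul, ← sub_nonneg]
    have := add_nonneg (sub_nonneg.2 hy_upper) (sub_nonneg.2 hscaled)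
    convert this using 1
    abel
  have hx_norm : ‖star x * x‖ ≤ max 0 (1 - ε / ‖b‖ ^ 2) := by
    refine (CStarAlgebra.norm_le_iff_le_algebraMap _ (le_max_left _ _)
      (star_mul_self_nonneg x)).2 (hx_le.trans ?_)
    rw [← Algebra.algebraMap_eq_smul_one]
    exact algebraMap_mono A (le_max_right _ _)
  have hlt : max 0 (1 - ε / ‖b‖ ^ 2) < 1 :=
    max_lt one_pos (sub_lt_self _ (div_pos hε hb0))
  rw [CStarRing.norm_star_mul_self] at hx_norm
  nlinarith [norm_nonneg x]
end

section
/- Let H be a complex Hilbert space and let x be a bounded linear operator on H with ‖x‖ < 1. Then 1 − x and 1 − x* are invertible, ‖(1 − x*)⁻¹ ξ‖ ≥ 2⁻¹‖ξ‖ for every ξ ∈ H, and (1 − x)⁻¹(1 − x x*)(1 − x*)⁻¹ ≥ 4⁻¹(1 − ‖x‖²)·1. -/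
/-- Estimates from the proof of (i) ⇒ (ii) in Lemma 3.4, for a bounded operator
`x` on a complex Hilbert space `H` with `‖x‖ < 1`: `1 - x` and `1 - x*` are
invertible, `‖(1 - x*)⁻¹ ξ‖ ≥ 2⁻¹ ‖ξ‖` for all `ξ`, and
`(1 - x)⁻¹ (1 - x x*) (1 - x*)⁻¹ ≥ 4⁻¹ (1 - ‖x‖²) • 1` in the Loewner order. -/
theorem inv_one_sub_conj_ge_of_norm_lt_one
    {H : Type*} [NormedAddCommGroup H] [InnerProductSpace ℂ H] [CompleteSpace H]
    (x : H →L[ℂ] H) (hx : ‖x‖ < 1) :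
    IsUnit (1 - x) ∧ IsUnit (1 - ContinuousLinearMap.adjoint x) ∧
      (∀ ξ : H, 2⁻¹ * ‖ξ‖ ≤ ‖Ring.inverse (1 - ContinuousLinearMap.adjoint x) ξ‖) ∧
      (4⁻¹ * (1 - ‖x‖ ^ 2)) • (1 : H →L[ℂ] H) ≤
        Ring.inverse (1 - x) * (1 - x * ContinuousLinearMap.adjoint x) *
          Ring.inverse (1 - ContinuousLinearMap.adjoint x) := by
  have hadj : ‖ContinuousLinearMap.adjoint x‖ = ‖x‖ := by simp
  have h₁ : IsUnit (1 - x) := isUnit_one_sub_of_norm_lt_one hx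
  have h₂ : IsUnit (1 - ContinuousLinearMap.adjoint x) :=
    isUnit_one_sub_of_norm_lt_one (hadj.trans_lt hx)
  have hinv : Ring.inverse (1 - x) =
      ContinuousLinearMap.adjoint (Ring.inverse (1 - ContinuousLinearMap.adjoint x)) := by
    simp only [← ContinuousLinearMap.star_eq_adjoint, ← Ring.inverse_star, star_sub, star_one,
      star_star]
  have hcancel := Ring.mul_inverse_cancel _ h₂
  rw [hinv]
  generalize Ring.inverse (1 - ContinuousLinearMap.adjoint x) = S at hcancel ⊢
  have hbound (η : H) : ‖ContinuousLinearMap.adjoint x η‖ ≤ ‖x‖ * ‖η‖ := by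
    simpa only [hadj] using (ContinuousLinearMap.adjoint x).le_opNorm η
  have hS (ξ : H) : 2⁻¹ * ‖ξ‖ ≤ ‖S ξ‖ := by
    have hξ : S ξ - ContinuousLinearMap.adjoint x (S ξ) = ξ := by
      simpa using DFunLike.congr_fun hcancel ξ
    have htri := norm_sub_le (S ξ) (ContinuousLinearMap.adjoint x (S ξ))
    rw [hξ] at htri
    nlinarith [hbound (S ξ), norm_nonneg (S ξ)]
  refine ⟨h₁, h₂, hS, ?_⟩
  rw [ContinuousLinearMap.le_def, ContinuousLinearMap.isPositive_def']
  refine ⟨?_, fun ξ => ?_⟩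
  · simp only [← ContinuousLinearMap.star_eq_adjoint, IsSelfAdjoint, star_sub, star_mul, star_star,
      star_one, star_smul, star_trivial, mul_assoc]
  · have hre : (ContinuousLinearMap.adjoint S * (1 - x * ContinuousLinearMap.adjoint x) * S -
        (4⁻¹ * (1 - ‖x‖ ^ 2)) • (1 : H →L[ℂ] H)).reApplyInnerSelf ξ =
        ‖S ξ‖ ^ 2 - ‖ContinuousLinearMap.adjoint x (S ξ)‖ ^ 2 -
          4⁻¹ * (1 - ‖x‖ ^ 2) * ‖ξ‖ ^ 2 := by
      have hx' (η : H) : inner ℂ (x (ContinuousLinearMap.adjoint x η)) η =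
          inner ℂ (ContinuousLinearMap.adjoint x η) (ContinuousLinearMap.adjoint x η) :=
        (ContinuousLinearMap.adjoint_inner_right x _ _).symm
      simp only [ContinuousLinearMap.reApplyInnerSelf_apply, sub_apply, mul_apply_eq_comp,
        smul_apply, one_apply_eq_self, inner_sub_left,
        ContinuousLinearMap.adjoint_inner_left, inner_smul_left_eq_smul, map_sub, RCLike.smul_re,
        inner_self_eq_norm_sq]
      rw [hx', inner_self_eq_norm_sq]
    rw [hre]
    have hxS := pow_le_pow_left₀ (norm_nonneg _) (hbound (S ξ)) 2
    have hξS := pow_le_pow_left₀ (by positivity) (hS ξ) 2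
    have hx2 : 0 ≤ 1 - ‖x‖ ^ 2 := by nlinarith [norm_nonneg x]
    nlinarith [mul_le_mul_of_nonneg_left hξS hx2]
end

section
/- Let A be a unital C*-algebra and let T ∈ A. Then T ∈ H₊(A) if and only if T is invertible and T⁻¹ ∈ H₋(A); moreover, when T is invertible, Im(T⁻¹) = −T⁻¹ (Im T) (T⁻¹)*. -/
/-- The imaginary part `Im T := (T - T*)/(2i)` of an element of a C*-algebra. -/
noncomputable def cstarIm {A : Type*} [CStarAlgebra A] (T : A) : A :=
  ((2 * Complex.I)⁻¹ : ℂ) • (T - star T)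

/-- The upper half-plane `H₊(A) = {T : Im T ≥ ε • 1 for some ε > 0}`. -/
def upperHalfPlaneCStar (A : Type*) [CStarAlgebra A] [PartialOrder A] : Set A :=
  {T : A | ∃ ε : ℝ, 0 < ε ∧ ε • (1 : A) ≤ cstarIm T}

/-- The lower half-plane `H₋(A) = -H₊(A)`. -/
def lowerHalfPlaneCStar (A : Type*) [CStarAlgebra A] [PartialOrder A] : Set A :=
  -upperHalfPlaneCStar A

section UpperHalfPlane

variable {A : Type*} [CStarAlgebra A]

lemma cstarIm_neg (T : A) : cstarIm (-T) = -cstarIm T := by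
  simp only [cstarIm, star_neg, ← smul_neg]
  congr 1
  abel

lemma cstarIm_neg_star (T : A) : cstarIm (-star T) = cstarIm T := by
  simp only [cstarIm, star_neg, star_star]
  congr 1
  abel

lemma sub_star_eq_smul_cstarIm (T : A) : T - star T = (2 * Complex.I) • cstarIm T := by
  rw [cstarIm, smul_smul, mul_inv_cancel₀ (by simp), one_smul]

lemma cstarIm_ringInverse {T : A} (hT : IsUnit T) :
    cstarIm (Ring.inverse T) = -(Ring.inverse T * cstarIm T * star (Ring.inverse T)) := by
  have h : star T * star (Ring.inverse T) = 1 := by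
    rw [← star_mul, Ring.inverse_mul_cancel T hT, star_one]
  simp only [cstarIm, mul_smul_comm, smul_mul_assoc, ← smul_neg, mul_sub, sub_mul,
    Ring.inverse_mul_cancel T hT, one_mul]
  rw [mul_assoc, h, mul_one, neg_sub]

/-- The shifted element `T - i t` satisfies
`(T - i t)* (T - i t) = T* T - 2 t Im T + t²`. -/
lemma star_sub_mul_sub_smul_I (T : A) (t : ℝ) :
    star (T - ((t : ℂ) * Complex.I) • (1 : A)) * (T - ((t : ℂ) * Complex.I) • (1 : A)) =
      star T * T - (2 * t) • cstarIm T + (t ^ 2) • (1 : A) := by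
  have h : (2 * t) • cstarIm T = (-((t : ℂ) * Complex.I)) • (T - star T) := by
    rw [sub_star_eq_smul_cstarIm, smul_smul, ← Complex.coe_smul]
    congr 1
    push_cast
    linear_combination (2 * (t : ℂ)) * Complex.I_sq
  have h2 : (t ^ 2) • (1 : A) =
      (-(((t : ℂ) * Complex.I) * ((t : ℂ) * Complex.I))) • (1 : A) := by
    rw [← Complex.coe_smul]
    congr 1
    push_cast
    linear_combination (t : ℂ) ^ 2 * Complex.I_sq
  rw [h, h2]
  simp only [star_sub, star_smul, star_one, sub_mul, mul_sub, smul_mul_assoc, mul_smul_comm,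
    one_mul, mul_one, RCLike.star_def, map_mul, Complex.conj_ofReal, Complex.conj_I]
  module

variable [PartialOrder A] [StarOrderedRing A]

lemma sq_smul_one_le_star_mul_self {T : A} {ε : ℝ} (hε : 0 < ε)
    (h : ε • (1 : A) ≤ cstarIm T) : (ε ^ 2) • (1 : A) ≤ star T * T := by
  have h1 : 0 ≤ star T * T - (2 * ε) • cstarIm T + (ε ^ 2) • (1 : A) :=
    star_sub_mul_sub_smul_I T ε ▸ star_mul_self_nonneg _
  have h2 : 0 ≤ (2 * ε) • (cstarIm T - ε • (1 : A)) :=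
    smul_nonneg (by positivity) (sub_nonneg.2 h)
  rw [← sub_nonneg]
  convert add_nonneg h1 h2 using 1
  module

lemma isUnit_star_mul_self_of_smul_one_le {T : A} {ε : ℝ} (hε : 0 < ε)
    (h : ε • (1 : A) ≤ cstarIm T) : IsUnit (star T * T) := by
  refine CStarAlgebra.isUnit_of_le _ (sq_smul_one_le_star_mul_self hε h) ⟨?_, ?_⟩
  · exact smul_nonneg (by positivity) zero_le_one
  · exact isUnit_one.smul (Units.mk0 (ε ^ 2) (by positivity))

lemma isUnit_of_mem_upperHalfPlaneCStar {T : A} (hT : T ∈ upperHalfPlaneCStar A) :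
    IsUnit T := by
  obtain ⟨ε, hε, h⟩ := hT
  have hl := isUnit_star_mul_self_of_smul_one_le hε h
  have hr : IsUnit (T * star T) := by
    simpa using isUnit_star_mul_self_of_smul_one_le (T := -star T) hε
      (by rwa [cstarIm_neg_star])
  rw [isUnit_iff_exists_and_exists]
  exact ⟨⟨star T * Ring.inverse (T * star T), by
      rw [← mul_assoc, Ring.mul_inverse_cancel _ hr]⟩,
    ⟨Ring.inverse (star T * T) * star T, by
      rw [mul_assoc, Ring.inverse_mul_cancel _ hl]⟩⟩

lemma neg_ringInverse_mem_upperHalfPlaneCStar [Nontrivial A] {T : A}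
    (hT : T ∈ upperHalfPlaneCStar A) : -Ring.inverse T ∈ upperHalfPlaneCStar A := by
  have hu := isUnit_of_mem_upperHalfPlaneCStar hT
  obtain ⟨ε, hε, h⟩ := hT
  have hn : 0 < ‖T‖ := norm_pos_iff.2 hu.ne_zero
  refine ⟨ε / ‖T‖ ^ 2, by positivity, ?_⟩
  set S := Ring.inverse T with hS
  have hST : S * T = 1 := Ring.inverse_mul_cancel T hu
  rw [cstarIm_neg, cstarIm_ringInverse hu, neg_neg]
  have h1 : ε • (S * star S) ≤ S * cstarIm T * star S := by
    simpa using star_right_conjugate_le_conjugate h S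
  have h2 : (1 : A) ≤ (‖T‖ ^ 2) • (S * star S) := by
    have := star_right_conjugate_le_conjugate
      (CStarAlgebra.mul_star_le_algebraMap_norm_sq (a := T)) S
    have h3 : S * (T * star T) * star S = 1 := by
      rw [← mul_assoc, hST, one_mul, ← star_mul, hST, star_one]
    rwa [h3, Algebra.algebraMap_eq_smul_one, mul_smul_comm, mul_one, smul_mul_assoc] at this
  calc (ε / ‖T‖ ^ 2) • (1 : A) ≤ (ε / ‖T‖ ^ 2) • (‖T‖ ^ 2) • (S * star S) :=
        smul_le_smul_of_nonneg_left h2 (by positivity)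
    _ = ε • (S * star S) := by rw [smul_smul, div_mul_cancel₀ _ (by positivity)]
    _ ≤ _ := h1

end UpperHalfPlane

/-- Section 2 of the paper: `T ∈ H₊(A)` iff `T` is invertible with
`T⁻¹ ∈ H₋(A)`; moreover, for invertible `T`,
`Im (T⁻¹) = -T⁻¹ (Im T) (T⁻¹)*`. -/
theorem mem_upperHalfPlane_iff_isUnit_and_inv_mem_lowerHalfPlane
    {A : Type*} [CStarAlgebra A] [PartialOrder A] [StarOrderedRing A] [Nontrivial A]
    (T : A) :
    (T ∈ upperHalfPlaneCStar A ↔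
        IsUnit T ∧ Ring.inverse T ∈ lowerHalfPlaneCStar A) ∧
      (IsUnit T →
        cstarIm (Ring.inverse T) =
          -(Ring.inverse T * cstarIm T * star (Ring.inverse T))) := by
  refine ⟨⟨fun hT => ⟨isUnit_of_mem_upperHalfPlaneCStar hT,
    Set.mem_neg.2 (neg_ringInverse_mem_upperHalfPlaneCStar hT)⟩, ?_⟩, cstarIm_ringInverse⟩
  rintro ⟨⟨u, rfl⟩, hu⟩
  have h := neg_ringInverse_mem_upperHalfPlaneCStar (Set.mem_neg.1 hu)
  rwa [Ring.inverse_unit, ← Units.val_neg, Ring.inverse_unit, inv_neg, inv_inv, Units.val_neg,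
    neg_neg] at h
end

section
/- Let A be a unital C*-algebra and let φ : A → A be a ℂ-linear map that is unital (φ(1) = 1) and positive (φ maps positive elements to positive elements). If x ∈ A satisfies ‖x‖ < 1, then φ((1 − x)⁻¹) is invertible and the element y := 1 − (φ((1 − x)⁻¹))⁻¹ satisfies ‖y‖ < 1; equivalently, φ((1 − x)⁻¹) = (1 − y)⁻¹ for some y with ‖y‖ < 1. -/
section

variable {A : Type*} [CStarAlgebra A] [PartialOrder A] [StarOrderedRing A]

lemma norm_lt_one_iff_isStrictlyPositive_one_sub_star_mul_self [Nontrivial A] {x : A} :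
    ‖x‖ < 1 ↔ IsStrictlyPositive (1 - star x * x) := by
  constructor
  · intro hx
    have hr : 0 < 1 - ‖x‖ ^ 2 := by nlinarith [norm_nonneg x]
    refine (isStrictlyPositive_algebraMap (A := A) hr).of_le ?_
    rw [map_sub, map_one]
    exact sub_le_sub_left CStarAlgebra.star_mul_le_algebraMap_norm_sq 1
  · intro h
    have hmem : ‖star x * x‖ ∈ spectrum ℝ (star x * x) :=
      CStarAlgebra.norm_mem_spectrum_of_nonneg (star_mul_self_nonneg x)
    have hmem' : 1 - ‖star x * x‖ ∈ spectrum ℝ (1 - star x * x) := by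
      rw [← map_one (algebraMap ℝ A), ← spectrum.singleton_sub_eq]
      exact Set.sub_mem_sub rfl hmem
    have hpos := h.spectrum_pos hmem'
    rw [CStarRing.norm_star_mul_self] at hpos
    nlinarith [norm_nonneg x]

lemma Units.norm_one_sub_inv_lt_one_iff [Nontrivial A] (u : Aˣ) :
    ‖1 - (↑u⁻¹ : A)‖ < 1 ↔ IsStrictlyPositive (star (u : A) + u - 1) := by
  have hstar : star (u : A) * star (↑u⁻¹ : A) = 1 := by
    rw [← star_mul, Units.inv_mul, star_one]
  have hconj : star (u : A) * (1 - star (1 - (↑u⁻¹ : A)) * (1 - ↑u⁻¹)) * u =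
      star (u : A) + u - 1 := by
    calc
      _ = star (u : A) * (↑u⁻¹ * u) + star (u : A) * star (↑u⁻¹ : A) * u
          - star (u : A) * star (↑u⁻¹ : A) * (↑u⁻¹ * u) := by
        rw [star_sub, star_one]; noncomm_ring
      _ = _ := by rw [hstar, Units.inv_mul]; simp
  rw [norm_lt_one_iff_isStrictlyPositive_one_sub_star_mul_self, ← hconj,
    u.isUnit.isStrictlyPositive_star_left_conjugate_iff]

lemma isUnit_of_one_le_star_add_self [Nontrivial A] {c : A} (hc : 1 ≤ star c + c) :
    IsUnit c := by
  set t : ℝ := (‖c‖ ^ 2 + 1)⁻¹ with ht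
  have ht0 : 0 < t := by positivity
  have htc : t * ‖c‖ ^ 2 < 1 := by
    rw [ht, inv_mul_lt_one₀ (by positivity)]
    linarith
  have hnorm : ‖1 - t • c‖ < 1 := by
    rw [norm_lt_one_iff_isStrictlyPositive_one_sub_star_mul_self]
    have hr : 0 < t * (1 - t * ‖c‖ ^ 2) := mul_pos ht0 (by linarith)
    refine (isStrictlyPositive_algebraMap (A := A) hr).of_le ?_
    have hle : t • (1 : A) - (t * t) • algebraMap ℝ A (‖c‖ ^ 2) ≤
        t • (star c + c) - (t * t) • (star c * c) :=
      sub_le_sub (smul_le_smul_of_nonneg_left hc ht0.le)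
        (smul_le_smul_of_nonneg_left CStarAlgebra.star_mul_le_algebraMap_norm_sq (by positivity))
    convert hle using 1
    · simp only [Algebra.algebraMap_eq_smul_one, smul_smul, ← sub_smul]
      congr 1
      ring
    · simp only [star_sub, star_one, star_smul, star_trivial, sub_mul, mul_sub, one_mul, mul_one,
        smul_mul_smul_comm, smul_add]
      abel
  have hunit : IsUnit (t • c) := by
    simpa using isUnit_one_sub_of_norm_lt_one hnorm
  simpa [Units.smul_def, smul_smul, ht0.ne'] using hunit.smul (Units.mk0 t ht0.ne')⁻¹

lemma IsStrictlyPositive.map_of_map_one [Nontrivial A] {B : Type*} [CStarAlgebra B]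
    [PartialOrder B] [StarOrderedRing B] (φ : A →ₚ[ℂ] B) (hφ : φ 1 = 1) {a : A}
    (ha : IsStrictlyPositive a) : IsStrictlyPositive (φ a) := by
  obtain ⟨r, hr, hra⟩ := (CFC.exists_pos_algebraMap_le_iff ha.isSelfAdjoint).2
    fun _ h ↦ ha.spectrum_pos h
  refine (isStrictlyPositive_algebraMap (A := B) hr).of_le ?_
  have h := OrderHomClass.mono φ hra
  rwa [Algebra.algebraMap_eq_smul_one, ← Complex.coe_smul, map_smul, hφ, Complex.coe_smul,
    ← Algebra.algebraMap_eq_smul_one] at h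

end

/-- Mechanism behind Proposition 3.5 and Theorem 3.6 of the paper: if `φ` is a
unital positive linear map on a unital C*-algebra and `‖x‖ < 1`, then
`φ((1 - x)⁻¹)` is invertible and `y := 1 - (φ((1 - x)⁻¹))⁻¹` satisfies
`‖y‖ < 1`, i.e. `φ((1 - x)⁻¹) = (1 - y)⁻¹` with `‖y‖ < 1`. -/
theorem isUnit_map_inv_one_sub_and_norm_lt_one
    {A : Type*} [CStarAlgebra A] [PartialOrder A] [StarOrderedRing A] [Nontrivial A]
    (φ : A →ₗ[ℂ] A) (hunital : φ 1 = 1) (hpos : ∀ a : A, 0 ≤ a → 0 ≤ φ a)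
    (x : A) (hx : ‖x‖ < 1) :
    IsUnit (φ (Ring.inverse (1 - x))) ∧
      ‖1 - Ring.inverse (φ (Ring.inverse (1 - x)))‖ < 1 := by
  let ψ : A →ₚ[ℂ] A := .mk₀ φ hpos
  change IsUnit (ψ (Ring.inverse (1 - x))) ∧ ‖1 - Ring.inverse (ψ (Ring.inverse (1 - x)))‖ < 1
  have hψ : ψ 1 = 1 := hunital
  obtain ⟨v, hv⟩ := isUnit_one_sub_of_norm_lt_one hx
  have hre : IsStrictlyPositive (star (↑v⁻¹ : A) + ↑v⁻¹ - 1) := by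
    rw [← Units.norm_one_sub_inv_lt_one_iff, inv_inv, hv]
    simpa using hx
  have hre' := hre.map_of_map_one ψ hψ
  rw [map_sub, map_add, map_star, hψ] at hre'
  rw [← hv, Ring.inverse_unit]
  have hunit : IsUnit (ψ ↑v⁻¹) := isUnit_of_one_le_star_add_self (sub_nonneg.1 hre'.nonneg)
  refine ⟨hunit, ?_⟩
  obtain ⟨w, hw⟩ := hunit
  rw [← hw] at hre' ⊢
  rw [Ring.inverse_unit]
  exact w.norm_one_sub_inv_lt_one_iff.2 hre'
end
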